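/- Let r ≥ 4 and let B_{r,r} be the graph consisting of two disjoint copies of K_r plus one edge joining them. Then: (i) for every n divisible by r, there is a B_{r,r}-saturated graph on n vertices containing no copy of C_{r+1}, so sat(n, C_{r+1}, B_{r,r}) = 0; and (ii) for every n ≥ 2r with n not divisible by r, every B_{r,r}-saturated graph on n vertices contains a copy of C_{r+1}, so sat(n, C_{r+1}, B_{r,r}) ≥ 1. -/

import Mathlib

open SimpleGraph Finset

variable {V : Type*}

/-- The graph `G` with the edge `u v` added. -/
def addEdge (G : SimpleGraph V) (u v : V) : SimpleGraph V :=
  G ⊔ SimpleGraph.fromEdgeSet {s(u, v)}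

/-- `G` is `K_s`-saturated: `G` is `K_s`-free and adding any missing edge creates a `K_s`. -/
def KSat (s : ℕ) (G : SimpleGraph V) : Prop :=
  G.CliqueFree s ∧ ∀ u v : V, u ≠ v → ¬ G.Adj u v → ¬ (addEdge G u v).CliqueFree s

/-- The number of copies of `K_r` in `G`: the number of `r`-sets of vertices inducing
a complete graph. -/
noncomputable def cliqueCount (G : SimpleGraph V) (r : ℕ) : ℕ :=
  {t : Finset V | G.IsNClique r t}.ncard

/-- `sat(n, K_r, K_s)`: minimum number of copies of `K_r` in an `n`-vertex
`K_s`-saturated graph. -/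
noncomputable def satCliques (n r s : ℕ) : ℕ :=
  sInf {m | ∃ G : SimpleGraph (Fin n), KSat s G ∧ cliqueCount G r = m}

/-- The join `K_{s-2} ∗ ∅_{n-s+2}` on `Fin n`. -/
def joinGraph (n s : ℕ) : SimpleGraph (Fin n) :=
  SimpleGraph.fromRel (fun i _ => (i : ℕ) < s - 2)

/-- The number of copies of `C_r` in `G` : the number of subgraphs of `G`
isomorphic to the cycle on `r` vertices. -/
noncomputable def cycleCount (G : SimpleGraph V) (r : ℕ) : ℕ :=
  {H : G.Subgraph | Nonempty (H.coe ≃g cycleGraph r)}.ncard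

/-- `sat(n, C_r, K_s)`. -/
noncomputable def satCyclesCliqueSat (n r s : ℕ) : ℕ :=
  sInf {m | ∃ G : SimpleGraph (Fin n), KSat s G ∧ cycleCount G r = m}

/-- `G` contains a copy of `F`, i.e. a subgraph isomorphic to `F`. -/
def ContainsCopy {α β : Type*} (F : SimpleGraph α) (G : SimpleGraph β) : Prop :=
  ∃ f : α → β, Function.Injective f ∧ ∀ a b : α, F.Adj a b → G.Adj (f a) (f b)

/-- strongly K_s-saturated -/
def StronglyKSat (s : ℕ) (G : SimpleGraph V) : Prop :=
  ∀ u v : V, u ≠ v → ¬ G.Adj u v →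
    ∃ t : Finset V, (addEdge G u v).IsNClique s t ∧ u ∈ t ∧ v ∈ t

/-- dumbbell -/
def dumbbell (m : ℕ) : SimpleGraph (Fin (2 * m)) :=
  SimpleGraph.fromRel (fun i j =>
    ((i : ℕ) < m ∧ (j : ℕ) < m) ∨ (m ≤ (i : ℕ) ∧ m ≤ (j : ℕ)) ∨ ((i : ℕ) = 0 ∧ (j : ℕ) = m))

def Vgraph (m : ℕ) : SimpleGraph (Fin (m + 2)) :=
  SimpleGraph.fromRel (fun i j =>
    ((i : ℕ) < m ∧ (j : ℕ) < m) ∨ ((i : ℕ) = 0 ∧ m ≤ (j : ℕ)))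

def lambdaGraph (m : ℕ) : SimpleGraph (Fin (m + 1)) :=
  SimpleGraph.fromRel (fun i j =>
    ((i : ℕ) < m ∧ (j : ℕ) < m) ∨ ((i : ℕ) = m ∧ (j : ℕ) < 2))

def VgraphGen (m r : ℕ) : SimpleGraph (Fin (m + (m - r))) :=
  SimpleGraph.fromRel (fun i j =>
    ((i : ℕ) < m ∧ (j : ℕ) < m) ∨
      (((i : ℕ) = 0 ∨ m ≤ (i : ℕ)) ∧ ((j : ℕ) = 0 ∨ m ≤ (j : ℕ))))

def lambdaGraphGen (m r : ℕ) : SimpleGraph (Fin (m + 1)) :=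
  SimpleGraph.fromRel (fun i j =>
    ((i : ℕ) < m ∧ (j : ℕ) < m) ∨ ((i : ℕ) = m ∧ (j : ℕ) < r))

/-- `G` is saturated with respect to the family `{F₁, F₂, F₃}`. -/
def FamSat3 {α₁ α₂ α₃ : Type*} (F₁ : SimpleGraph α₁) (F₂ : SimpleGraph α₂)
    (F₃ : SimpleGraph α₃) (G : SimpleGraph V) : Prop :=
  ¬ ContainsCopy F₁ G ∧ ¬ ContainsCopy F₂ G ∧ ¬ ContainsCopy F₃ G ∧
    ∀ u v : V, u ≠ v → ¬ G.Adj u v →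
      ContainsCopy F₁ (addEdge G u v) ∨ ContainsCopy F₂ (addEdge G u v) ∨
        ContainsCopy F₃ (addEdge G u v)

noncomputable def satFam3 {α₁ α₂ α₃ : Type*} (n : ℕ) (F₁ : SimpleGraph α₁)
    (F₂ : SimpleGraph α₂) (F₃ : SimpleGraph α₃) : ℕ :=
  sInf {m | ∃ G : SimpleGraph (Fin n), FamSat3 F₁ F₂ F₃ G ∧ G.edgeSet.ncard = m}

noncomputable def satCliquesFam3 {α₁ α₂ α₃ : Type*} (n r : ℕ) (F₁ : SimpleGraph α₁)
    (F₂ : SimpleGraph α₂) (F₃ : SimpleGraph α₃) : ℕ :=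
  sInf {m | ∃ G : SimpleGraph (Fin n), FamSat3 F₁ F₂ F₃ G ∧ cliqueCount G r = m}

/-- saturation w.r.t. a single graph, with copies as subgraphs. -/
def SatGraph {α : Type*} (F : SimpleGraph α) (G : SimpleGraph V) : Prop :=
  ¬ ContainsCopy F G ∧ ∀ u v : V, u ≠ v → ¬ G.Adj u v → ContainsCopy F (addEdge G u v)

noncomputable def satCyclesGraphSat {α : Type*} (n r : ℕ) (F : SimpleGraph α) : ℕ :=
  sInf {m | ∃ G : SimpleGraph (Fin n), SatGraph F G ∧ cycleCount G r = m}

/-- number of independent sets of size l -/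
noncomputable def indepCount (G : SimpleGraph V) (l : ℕ) : ℕ :=
  {t : Finset V | t.card = l ∧ ∀ a ∈ t, ∀ b ∈ t, ¬ G.Adj a b}.ncard

/-- Ramsey number -/
noncomputable def ramsey (l s : ℕ) : ℕ :=
  sInf {N | ∀ G : SimpleGraph (Fin N),
    (∃ t : Finset (Fin N), t.card = l ∧ ∀ a ∈ t, ∀ b ∈ t, ¬ G.Adj a b) ∨
      ∃ t : Finset (Fin N), G.IsNClique s t}

theorem addEdge_adj (G : SimpleGraph V) (u v a b : V) :
    (addEdge G u v).Adj a b ↔ G.Adj a b ∨ (s(a, b) = s(u, v) ∧ a ≠ b) := by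
  simp [addEdge]

theorem le_addEdge (G : SimpleGraph V) (u v : V) : G ≤ addEdge G u v := le_sup_left

theorem dumbbell_adj {m : ℕ} (i j : Fin (2 * m)) :
    (dumbbell m).Adj i j ↔ i ≠ j ∧
      (((i : ℕ) < m ∧ (j : ℕ) < m) ∨ (m ≤ (i : ℕ) ∧ m ≤ (j : ℕ)) ∨
        ((i : ℕ) = 0 ∧ (j : ℕ) = m) ∨ ((j : ℕ) = 0 ∧ (i : ℕ) = m)) := by
  simp only [dumbbell, SimpleGraph.fromRel_adj]
  tauto

theorem exists_equiv_fin_apply_zero {r : ℕ} (hr : 0 < r) {A : Finset V} (hA : #A = r)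
    {a : V} (ha : a ∈ A) : ∃ e : Fin r ≃ A, e ⟨0, hr⟩ = ⟨a, ha⟩ := by
  let e := (A.equivFinOfCardEq hA).symm
  exact ⟨(Equiv.swap ⟨0, hr⟩ (e.symm ⟨a, ha⟩)).trans e, by simp⟩

theorem containsCopy_dumbbell {G : SimpleGraph V} {r : ℕ} {A B : Finset V}
    (hA : G.IsNClique r A) (hB : G.IsNClique r B) (hAB : Disjoint A B) {a b : V}
    (ha : a ∈ A) (hb : b ∈ B) (hab : G.Adj a b) : ContainsCopy (dumbbell r) G := by
  have hr : 0 < r := hA.card_eq ▸ Finset.card_pos.2 ⟨a, ha⟩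
  obtain ⟨e, he⟩ := exists_equiv_fin_apply_zero hr hA.card_eq ha
  obtain ⟨g, hg⟩ := exists_equiv_fin_apply_zero hr hB.card_eq hb
  let f : Fin (2 * r) → V := fun i =>
    if h : (i : ℕ) < r then e ⟨i, h⟩ else g ⟨i - r, by omega⟩
  have f_left (i : Fin (2 * r)) (h : (i : ℕ) < r) : f i = e ⟨i, h⟩ := by simp [f, h]
  have f_right (i : Fin (2 * r)) (h : r ≤ (i : ℕ)) : f i = g ⟨i - r, by omega⟩ := by
    simp [f, not_lt.2 h]
  have hinj : Function.Injective f := by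
    intro i j hij
    rcases lt_or_ge (i : ℕ) r with hi | hi <;> rcases lt_or_ge (j : ℕ) r with hj | hj
    · rw [f_left i hi, f_left j hj] at hij
      have := e.injective (Subtype.ext hij)
      simpa [Fin.ext_iff] using this
    · rw [f_left i hi, f_right j hj] at hij
      exact (Finset.disjoint_left.1 hAB (e _).2 (hij ▸ (g _).2)).elim
    · rw [f_right i hi, f_left j hj] at hij
      exact (Finset.disjoint_left.1 hAB (e _).2 (hij ▸ (g _).2)).elim
    · rw [f_right i hi, f_right j hj] at hij
      have := g.injective (Subtype.ext hij)
      simp only [Fin.ext_iff] at this ⊢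
      omega
  have f_bridge (i j : Fin (2 * r)) (hi : (i : ℕ) = 0) (hj : (j : ℕ) = r) : G.Adj (f i) (f j) := by
    rw [f_left i (by omega), f_right j hj.ge]
    simpa only [hi, hj, Nat.sub_self, he, hg] using hab
  refine ⟨f, hinj, fun i j hij => ?_⟩
  rw [dumbbell_adj] at hij
  obtain ⟨hne, ⟨hi, hj⟩ | ⟨hi, hj⟩ | ⟨hi, hj⟩ | ⟨hj, hi⟩⟩ := hij
  · have := hinj.ne hne
    rw [f_left i hi, f_left j hj] at this ⊢
    exact hA.isClique (e _).2 (e _).2 this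
  · have := hinj.ne hne
    rw [f_right i hi, f_right j hj] at this ⊢
    exact hB.isClique (g _).2 (g _).2 this
  · exact f_bridge i j hi hj
  · exact (f_bridge j i hj hi).symm

theorem ContainsCopy.exists_cliques {G : SimpleGraph V} {r : ℕ} (hr : 0 < r)
    (h : ContainsCopy (dumbbell r) G) : ∃ A B : Finset V, G.IsNClique r A ∧ G.IsNClique r B ∧
      Disjoint A B ∧ ∃ a ∈ A, ∃ b ∈ B, G.Adj a b := by
  obtain ⟨f, hf, hadj⟩ := h
  let l : Fin r ↪ V := ⟨fun i => f ⟨i, by omega⟩, fun i j hij => by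
    simpa [Fin.ext_iff] using hf hij⟩
  let g : Fin r ↪ V := ⟨fun i => f ⟨r + i, by omega⟩, fun i j hij => by
    simpa [Fin.ext_iff] using hf hij⟩
  refine ⟨univ.map l, univ.map g, ⟨?_, by simp⟩, ⟨?_, by simp⟩, ?_, l ⟨0, hr⟩, by simp,
    g ⟨0, hr⟩, by simp, hadj _ _ ?_⟩
  · intro x hx y hy hxy
    simp only [coe_map, coe_univ, Set.image_univ, Set.mem_range] at hx hy
    obtain ⟨i, rfl⟩ := hx
    obtain ⟨j, rfl⟩ := hy
    refine hadj _ _ ((dumbbell_adj _ _).2 ⟨fun h => hxy (congrArg f h), Or.inl ?_⟩)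
    simp
  · intro x hx y hy hxy
    simp only [coe_map, coe_univ, Set.image_univ, Set.mem_range] at hx hy
    obtain ⟨i, rfl⟩ := hx
    obtain ⟨j, rfl⟩ := hy
    refine hadj _ _ ((dumbbell_adj _ _).2 ⟨fun h => hxy (congrArg f h), Or.inr (Or.inl ?_)⟩)
    simp
  · rw [Finset.disjoint_left]
    intro x hx hy
    simp only [Finset.mem_map, Finset.mem_univ, true_and] at hx hy
    obtain ⟨i, rfl⟩ := hx
    obtain ⟨j, hj⟩ := hy
    have := hf hj
    simp only [Fin.ext_iff] at this
    omega
  · refine (dumbbell_adj _ _).2 ⟨?_, by simp⟩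
    simp only [ne_eq, Fin.ext_iff]
    omega

theorem dumbbell_preconnected {r : ℕ} (hr : 0 < r) : (dumbbell r).Preconnected := by
  have hreach (i : Fin (2 * r)) : (dumbbell r).Reachable ⟨0, by omega⟩ i := by
    have hbridge : (dumbbell r).Adj ⟨0, by omega⟩ ⟨r, by omega⟩ :=
      (dumbbell_adj _ _).2 ⟨by simp [Fin.ext_iff]; omega, by simp⟩
    rcases lt_or_ge (i : ℕ) r with hi | hi
    · by_cases h : (⟨0, by omega⟩ : Fin (2 * r)) = i
      · rw [h]
      · exact ((dumbbell_adj _ _).2 ⟨h, by simp [hi, hr]⟩ : (dumbbell r).Adj _ _).reachable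
    · by_cases h : (⟨r, by omega⟩ : Fin (2 * r)) = i
      · rw [← h]; exact hbridge.reachable
      · exact hbridge.reachable.trans
          ((dumbbell_adj _ _).2 ⟨h, by simp [hi]⟩ : (dumbbell r).Adj _ _).reachable
  exact fun i j => (hreach i).symm.trans (hreach j)

theorem cycleCount_eq_zero_iff [Finite V] {G : SimpleGraph V} {k : ℕ} :
    cycleCount G k = 0 ↔ ¬ ContainsCopy (cycleGraph k) G := by
  rw [cycleCount, Set.ncard_eq_zero (Set.toFinite _), Set.eq_empty_iff_forall_notMem]
  constructor
  · rintro h ⟨f, hf, hadj⟩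
    let c : (cycleGraph k).Copy G := ⟨⟨f, fun {a b} => hadj a b⟩, hf⟩
    exact h c.toSubgraph ⟨c.isoToSubgraph.symm⟩
  · rintro h H ⟨e⟩
    exact h ⟨fun i => e.symm i, Subtype.val_injective.comp e.symm.injective,
      fun a b hab => H.coe_adj_sub _ _ (e.symm.map_adj_iff.2 hab)⟩

theorem containsCopy_cycleGraph_of_list {G : SimpleGraph V} {k : ℕ} {l : List V} (hl : l.Nodup)
    (hk : l.length = k) (hc : l.IsChain G.Adj) (hne : l ≠ [])
    (hlast : G.Adj (l.getLast hne) (l.head hne)) : ContainsCopy (cycleGraph k) G := by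
  subst hk
  have hstep (i j : Fin l.length) (h : (j - i).val = 1) : G.Adj l[i] l[j] := by
    rw [List.getLast_eq_getElem, List.head_eq_getElem] at hlast
    rw [Fin.val_sub] at h
    have hij : (j : ℕ) = i + 1 ∨ ((i : ℕ) = l.length - 1 ∧ (j : ℕ) = 0) := by
      have hi := i.2
      have hj := j.2
      rcases lt_or_ge (l.length - i + j) l.length with h' | h'
      · rw [Nat.mod_eq_of_lt h'] at h
        omega
      · rw [Nat.mod_eq_sub_mod h', Nat.mod_eq_of_lt (by omega)] at h
        omega
    obtain hij | ⟨hi, hj⟩ := hij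
    · have := hc.getElem i (by omega)
      simpa [hij] using this
    · simpa [hi, hj] using hlast
  refine ⟨fun i => l[i], fun i j hij => Fin.ext ((hl.getElem_inj_iff).1 hij), fun i j hij => ?_⟩
  rw [cycleGraph_adj'] at hij
  exact hij.elim (fun h => (hstep j i h).symm) (hstep i j)

/-- A path with `m.length` internal vertices outside a clique `Q`, joining two vertices of `Q`,
closes up through `Q` to a cycle of any length `k` from `m.length + 2` to `m.length + #Q`. -/
theorem containsCopy_cycleGraph_of_path {G : SimpleGraph V} {Q : Finset V} (hQ : G.IsClique Q)
    {k : ℕ} {p q : V} {m : List V} (hp : p ∈ Q) (hq : q ∈ Q) (hpq : p ≠ q)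
    (hm : m.Nodup) (hmQ : ∀ x ∈ m, x ∉ Q) (hc : (p :: m ++ [q]).IsChain G.Adj)
    (hk : m.length + 2 ≤ k) (hkQ : k ≤ m.length + #Q) : ContainsCopy (cycleGraph k) G := by
  classical
  obtain ⟨T, hT, hTc⟩ : ∃ T ⊆ (Q.erase p).erase q, #T = k - (m.length + 2) := by
    refine Finset.exists_subset_card_eq ?_
    rw [card_erase_of_mem (mem_erase.2 ⟨hpq.symm, hq⟩), card_erase_of_mem hp]
    omega
  have hTmem {x : V} (hx : x ∈ T) : x ≠ q ∧ x ≠ p ∧ x ∈ Q := by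
    simpa using hT hx
  have htail {x : V} (hx : x ∈ q :: T.toList) : x ≠ p ∧ x ∈ Q := by
    rcases List.mem_cons.1 hx with rfl | hx
    · exact ⟨hpq.symm, hq⟩
    · exact (hTmem (by simpa using hx)).2
  have htail_nodup : (q :: T.toList).Nodup :=
    List.nodup_cons.2 ⟨fun h => (hTmem (by simpa using h)).1 rfl, T.nodup_toList⟩
  refine containsCopy_cycleGraph_of_list (l := p :: m ++ q :: T.toList) ?_ ?_ ?_ (by simp) ?_
  · refine List.nodup_append.2 ⟨List.nodup_cons.2 ⟨fun h => hmQ p h hp, hm⟩, htail_nodup, ?_⟩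
    rintro x hx _ hy rfl
    rcases List.mem_cons.1 hx with rfl | hx
    · exact (htail hy).1 rfl
    · exact hmQ x hx (htail hy).2
  · simp [hTc]; omega
  · have hclique : (q :: T.toList).IsChain G.Adj := by
      refine List.Pairwise.isChain (List.Pairwise.imp_of_mem ?_ htail_nodup)
      exact fun hx hy hxy => hQ (htail hx).2 (htail hy).2 hxy
    have := List.IsChain.append_overlap hc (l₂ := [q]) (l₃ := T.toList) hclique (by simp)
    simpa using this
  · have hlast := htail (List.getLast_mem (l := q :: T.toList) (by simp))
    simpa using hQ hlast.2 hp hlast.1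

theorem SatGraph.exists_common_of_not_adj {G : SimpleGraph V} {r : ℕ} (hr : 4 ≤ r)
    (hG : SatGraph (dumbbell r) G) {u v : V} (huv : u ≠ v) (hadj : ¬ G.Adj u v) :
    (∃ Q : Finset V, G.IsNClique r Q) ∧
    ((∃ A B : Finset V, G.IsNClique r A ∧ G.IsNClique r B ∧ Disjoint A B ∧ u ∈ A ∧ v ∈ B) ∨
      ∃ y z : V, y ≠ z ∧ G.Adj u y ∧ G.Adj v y ∧ G.Adj u z ∧ G.Adj v z) := by
  classical
  have clique_of {A : Finset V} (hA : (addEdge G u v).IsNClique r A) (h : ¬ (u ∈ A ∧ v ∈ A)) :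
      G.IsNClique r A := by
    refine ⟨fun x hx y hy hxy => ?_, hA.card_eq⟩
    obtain h' | ⟨h', -⟩ := (addEdge_adj ..).1 (hA.isClique hx hy hxy)
    · exact h'
    · rcases Sym2.eq_iff.1 h' with ⟨rfl, rfl⟩ | ⟨rfl, rfl⟩
      · exact (h ⟨hx, hy⟩).elim
      · exact (h ⟨hy, hx⟩).elim
  have common_of {A : Finset V} (hA : (addEdge G u v).IsNClique r A) (hu : u ∈ A) (hv : v ∈ A) :
      ∃ y z : V, y ≠ z ∧ G.Adj u y ∧ G.Adj v y ∧ G.Adj u z ∧ G.Adj v z := by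
    have hcard : 1 < #((A.erase u).erase v) := by
      rw [card_erase_of_mem (mem_erase.2 ⟨huv.symm, hv⟩), card_erase_of_mem hu, hA.card_eq]
      omega
    obtain ⟨y, hy, z, hz, hyz⟩ := Finset.one_lt_card.1 hcard
    have key {x : V} (hx : x ∈ (A.erase u).erase v) : G.Adj u x ∧ G.Adj v x := by
      simp only [mem_erase] at hx
      obtain ⟨hxv, hxu, hxA⟩ := hx
      have h₁ := (addEdge_adj ..).1 (hA.isClique hu hxA hxu.symm)
      have h₂ := (addEdge_adj ..).1 (hA.isClique hv hxA hxv.symm)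
      simp only [Sym2.eq_iff] at h₁ h₂
      tauto
    exact ⟨y, z, hyz, (key hy).1, (key hy).2, (key hz).1, (key hz).2⟩
  obtain ⟨A, B, hA, hB, hAB, a, ha, b, hb, hab⟩ :=
    (hG.2 u v huv hadj).exists_cliques (by omega)
  by_cases hAuv : u ∈ A ∧ v ∈ A
  · exact ⟨⟨B, clique_of hB fun h => Finset.disjoint_left.1 hAB hAuv.1 h.1⟩,
      Or.inr (common_of hA hAuv.1 hAuv.2)⟩
  by_cases hBuv : u ∈ B ∧ v ∈ B
  · exact ⟨⟨A, clique_of hA hAuv⟩, Or.inr (common_of hB hBuv.1 hBuv.2)⟩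
  have hA' := clique_of hA hAuv
  have hB' := clique_of hB hBuv
  refine ⟨⟨A, hA'⟩, Or.inl ?_⟩
  obtain hab' | ⟨hab', -⟩ := (addEdge_adj ..).1 hab
  · exact (hG.1 (containsCopy_dumbbell hA' hB' hAB ha hb hab')).elim
  · rcases Sym2.eq_iff.1 hab' with ⟨rfl, rfl⟩ | ⟨rfl, rfl⟩
    · exact ⟨A, B, hA', hB', hAB, ha, hb⟩
    · exact ⟨B, A, hB', hA', hAB.symm, hb, ha⟩

section NoCycle

variable {G : SimpleGraph V} {r : ℕ}

theorem eq_of_adj_of_not_containsCopy_cycleGraph (hr : 4 ≤ r)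
    (hC : ¬ ContainsCopy (cycleGraph (r + 1)) G) {Q : Finset V} (hQ : G.IsNClique r Q)
    {p q y : V} (hp : p ∈ Q) (hq : q ∈ Q) (hy : y ∉ Q) (hyp : G.Adj y p) (hyq : G.Adj y q) :
    p = q := by
  by_contra hpq
  refine hC (containsCopy_cycleGraph_of_path hQ.isClique hp hq hpq (m := [y]) (by simp)
    (by simpa using hy) ?_ (by simp; omega) (by simp [hQ.card_eq]))
  simp [hyp.symm, hyq]

theorem eq_of_path_of_not_containsCopy_cycleGraph (hr : 4 ≤ r)
    (hC : ¬ ContainsCopy (cycleGraph (r + 1)) G) {Q : Finset V} (hQ : G.IsNClique r Q)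
    {p q y z : V} (hp : p ∈ Q) (hq : q ∈ Q) (hy : y ∉ Q) (hz : z ∉ Q) (hyz : G.Adj y z)
    (hyp : G.Adj y p) (hzq : G.Adj z q) : p = q := by
  by_contra hpq
  refine hC (containsCopy_cycleGraph_of_path hQ.isClique hp hq hpq (m := [y, z])
    (by simpa using hyz.ne) (by simpa using ⟨hy, hz⟩) ?_ (by simp; omega)
    (by simp [hQ.card_eq]))
  simp [hyp.symm, hyz, hzq]

theorem disjoint_of_isNClique (hr : 4 ≤ r) (hG : SatGraph (dumbbell r) G)
    (hC : ¬ ContainsCopy (cycleGraph (r + 1)) G) {P Q : Finset V} (hP : G.IsNClique r P)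
    (hQ : G.IsNClique r Q) (hPQ : P ≠ Q) : Disjoint P Q := by
  have attach {Q : Finset V} (hQ : G.IsNClique r Q) {p q y : V} (hp : p ∈ Q) (hq : q ∈ Q)
      (hy : y ∉ Q) (hyp : G.Adj y p) (hyq : G.Adj y q) : p = q :=
    eq_of_adj_of_not_containsCopy_cycleGraph hr hC hQ hp hq hy hyp hyq
  have meet {P Q : Finset V} (hP : G.IsNClique r P) (hQ : G.IsNClique r Q) (hPQ : P ≠ Q)
      {x y : V} (hxP : x ∈ P) (hxQ : x ∈ Q) (hyP : y ∈ P) (hyQ : y ∈ Q) : x = y := by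
    obtain ⟨a, haP, haQ⟩ : ∃ a ∈ P, a ∉ Q := by
      by_contra! h
      exact hPQ (Finset.eq_of_subset_of_card_le h (by rw [hP.card_eq, hQ.card_eq]))
    exact attach hQ hxQ hyQ haQ (hP.isClique haP hxP fun h => haQ (h ▸ hxQ))
      (hP.isClique haP hyP fun h => haQ (h ▸ hyQ))
  have exists_ne {P : Finset V} (hP : G.IsNClique r P) (x : V) : ∃ a ∈ P, a ≠ x :=
    Finset.exists_mem_ne (by rw [hP.card_eq]; omega) x
  -- A clique through `a` avoiding the cut vertex `x` would send an edge to `Q`.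
  have no_bridge {A P Q : Finset V} (hA : G.IsNClique r A) (hP : G.IsNClique r P)
      (hQ : G.IsNClique r Q) {a x : V} (haP : a ∈ P) (hxP : x ∈ P) (hxQ : x ∈ Q) (haQ : a ∉ Q)
      (haA : a ∈ A) (hax : a ≠ x) : A = P := by
    by_contra hAP
    have hxA : x ∉ A := fun hxA => hax (meet hA hP hAP haA haP hxA hxP)
    have hadj : G.Adj a x := hP.isClique haP hxP hax
    refine hG.1 (containsCopy_dumbbell hA hQ ?_ haA hxQ hadj)
    rw [Finset.disjoint_left]
    intro y hyA hyQ
    have hay : a ≠ y := fun h => haQ (h ▸ hyQ)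
    exact hxA (attach hQ hxQ hyQ haQ hadj (hA.isClique haA hyA hay) ▸ hyA)
  by_contra hdisj
  obtain ⟨x, hxP, hxQ⟩ := Finset.not_disjoint_iff.1 hdisj
  obtain ⟨a, haP, hax⟩ := exists_ne hP x
  obtain ⟨b, hbQ, hbx⟩ := exists_ne hQ x
  have haQ : a ∉ Q := fun h => hax (meet hP hQ hPQ haP h hxP hxQ)
  have hbP : b ∉ P := fun h => hbx (meet hP hQ hPQ h hbQ hxP hxQ)
  have hadj_ax : G.Adj a x := hP.isClique haP hxP hax
  have hadj_bx : G.Adj b x := hQ.isClique hbQ hxQ hbx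
  have hab : ¬ G.Adj a b := fun h => hbx (attach hQ hbQ hxQ haQ h hadj_ax)
  have hne : a ≠ b := fun h => haQ (h ▸ hbQ)
  obtain ⟨A, B, hA, hB, hAB, haA, hbB⟩ | ⟨y, z, hyz, hay, hby, haz, hbz⟩ :=
    (hG.exists_common_of_not_adj hr hne hab).2
  · have h₁ := no_bridge hA hP hQ haP hxP hxQ haQ haA hax
    have h₂ := no_bridge hB hQ hP hbQ hxQ hxP hbP hbB hbx
    subst h₁ h₂
    exact hdisj hAB
  · have key {y : V} (hyx : y ≠ x) (hay : G.Adj a y) (hby : G.Adj b y) : False := by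
      have hyQ : y ∉ Q := fun h => hyx (attach hQ h hxQ haQ hay hadj_ax)
      exact hbx (eq_of_path_of_not_containsCopy_cycleGraph hr hC hQ hxQ hbQ haQ hyQ hay
        hadj_ax hby.symm).symm
    by_cases hyx : y = x
    · exact key (fun h => hyz (hyx.trans h.symm)) haz hbz
    · exact key hyx hay hby

theorem mem_some_isNClique (hr : 4 ≤ r) (hG : SatGraph (dumbbell r) G)
    (hC : ¬ ContainsCopy (cycleGraph (r + 1)) G) {Q : Finset V} (hQ : G.IsNClique r Q) (w : V) :
    ∃ P : Finset V, G.IsNClique r P ∧ w ∈ P := by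
  by_contra! hw
  have hcard : 1 < #Q := by rw [hQ.card_eq]; omega
  have no_common {w q : V} (hw : ∀ P : Finset V, G.IsNClique r P → w ∉ P) (hq : q ∈ Q)
      (hwq : ¬ G.Adj w q) : ∃ y, y ∉ Q ∧ G.Adj w y ∧ G.Adj q y := by
    obtain ⟨A, B, hA, -, -, hwA, -⟩ | ⟨y, z, hyz, hwy, hqy, hwz, hqz⟩ :=
      (hG.exists_common_of_not_adj hr (fun h : w = q => hw Q hQ (h.symm ▸ hq)) hwq).2
    · exact (hw A hA hwA).elim
    · by_cases hyQ : y ∈ Q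
      · refine ⟨z, fun hzQ => hyz ?_, hwz, hqz⟩
        exact eq_of_adj_of_not_containsCopy_cycleGraph hr hC hQ hyQ hzQ (hw Q hQ) hwy hwz
      · exact ⟨y, hyQ, hwy, hqy⟩
  have exists_nonadj {w : V} (hw : w ∉ Q) : ∃ q ∈ Q, ¬ G.Adj w q := by
    by_contra! h
    obtain ⟨p, hp, q, hq, hpq⟩ := Finset.one_lt_card.1 hcard
    exact hpq (eq_of_adj_of_not_containsCopy_cycleGraph hr hC hQ hp hq hw (h p hp) (h q hq))
  obtain ⟨q, hq, hwq⟩ := exists_nonadj (hw Q hQ)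
  obtain ⟨y, hyQ, -, hqy⟩ := no_common hw hq hwq
  have hy (P : Finset V) (hP : G.IsNClique r P) : y ∉ P := fun hyP => by
    have hPQ : P ≠ Q := fun h => hyQ (h ▸ hyP)
    exact hG.1 (containsCopy_dumbbell hP hQ (disjoint_of_isNClique hr hG hC hP hQ hPQ) hyP hq
      hqy.symm)
  obtain ⟨p, hp, hyp⟩ := exists_nonadj hyQ
  obtain ⟨z, hzQ, hyz, hpz⟩ := no_common hy hp hyp
  have := eq_of_path_of_not_containsCopy_cycleGraph hr hC hQ hq hp hyQ hzQ hyz hqy.symm hpz.symm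
  exact hyp (this ▸ hqy.symm)

theorem dvd_card_of_satGraph_dumbbell [Fintype V] (hr : 4 ≤ r) (hV : 2 * r ≤ Fintype.card V)
    (hG : SatGraph (dumbbell r) G) (hC : ¬ ContainsCopy (cycleGraph (r + 1)) G) :
    r ∣ Fintype.card V := by
  classical
  obtain ⟨Q, hQ⟩ : ∃ Q : Finset V, G.IsNClique r Q := by
    by_cases h : ∃ u v : V, u ≠ v ∧ ¬ G.Adj u v
    · obtain ⟨u, v, huv, hadj⟩ := h
      exact (hG.exists_common_of_not_adj hr huv hadj).1
    · push Not at h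
      obtain ⟨Q, -, hQ⟩ := Finset.exists_subset_card_eq (s := (univ : Finset V)) (n := r)
        (by rw [Finset.card_univ]; omega)
      exact ⟨Q, fun x _ y _ hxy => h x y hxy, hQ⟩
  have hcover : (univ.filter (G.IsNClique r)).biUnion id = (univ : Finset V) := by
    ext w
    simpa using mem_some_isNClique hr hG hC hQ w
  rw [← Finset.card_univ, ← hcover, Finset.card_biUnion]
  · refine Finset.dvd_sum fun P hP => ?_
    rw [id, (Finset.mem_filter.1 hP).2.card_eq]
  · intro P hP P' hP' hne
    exact disjoint_of_isNClique hr hG hC (Finset.mem_filter.1 hP).2 (Finset.mem_filter.1 hP').2 hne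

end NoCycle

theorem exists_satGraph {α : Type*} [Finite V] {F : SimpleGraph α} {a b : α} (hab : F.Adj a b) :
    ∃ G : SimpleGraph V, SatGraph F G := by
  have hne : {G : SimpleGraph V | ¬ ContainsCopy F G}.Nonempty :=
    ⟨⊥, fun ⟨_, _, h⟩ => h a b hab⟩
  obtain ⟨G, hG⟩ := (Set.toFinite _).exists_maximal hne
  refine ⟨G, hG.prop, fun u v huv hadj => ?_⟩
  by_contra h
  have hle := hG.le_of_ge (y := addEdge G u v) h (le_addEdge G u v)
  exact hadj (hle ((addEdge_adj ..).2 (Or.inr ⟨rfl, huv⟩)))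

/-- The disjoint union of cliques on consecutive blocks of `r` vertices. -/
def blockGraph (n r : ℕ) : SimpleGraph (Fin n) where
  Adj i j := i ≠ j ∧ (i : ℕ) / r = (j : ℕ) / r
  symm := ⟨fun _ _ h => ⟨h.1.symm, h.2.symm⟩⟩
  loopless := ⟨fun _ h => h.1 rfl⟩

/-- The `k`-th block of `blockGraph n r`. -/
def block (n r k : ℕ) : Finset (Fin n) := univ.filter fun i => (i : ℕ) / r = k

theorem mem_block {n r k : ℕ} {i : Fin n} : i ∈ block n r k ↔ (i : ℕ) / r = k := by
  simp [block]

theorem map_block_subset {n r : ℕ} (hr : 0 < r) (k : ℕ) :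
    (block n r k).map Fin.valEmbedding ⊆ Finset.Ico (k * r) (k * r + r) := by
  intro x hx
  obtain ⟨i, hi, rfl⟩ := Finset.mem_map.1 hx
  rw [mem_block, Nat.div_eq_iff hr] at hi
  simp only [Fin.valEmbedding_apply, Finset.mem_Ico]
  omega

theorem card_block_le {n r : ℕ} (hr : 0 < r) (k : ℕ) : #(block n r k) ≤ r := by
  simpa using Finset.card_le_card (map_block_subset (n := n) hr k)

theorem isNClique_block {n r : ℕ} (hr : 0 < r) (hn : r ∣ n) (i : Fin n) :
    (blockGraph n r).IsNClique r (block n r (i / r)) := by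
  refine ⟨fun x hx y hy hxy => ⟨hxy, (mem_block.1 hx).trans (mem_block.1 hy).symm⟩, ?_⟩
  have hsub : Finset.Ico (i / r * r) (i / r * r + r) ⊆
      (block n r (i / r)).map Fin.valEmbedding := by
    intro x hx
    rw [Finset.mem_Ico] at hx
    have hlt : x < n := by
      obtain ⟨c, rfl⟩ := hn
      have : (i : ℕ) / r < c := Nat.div_lt_of_lt_mul i.2
      calc x < i / r * r + r := hx.2
        _ = r * (i / r + 1) := by ring
        _ ≤ r * c := Nat.mul_le_mul_left r this
    refine Finset.mem_map.2 ⟨⟨x, hlt⟩, mem_block.2 ?_, rfl⟩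
    rw [Nat.div_eq_iff hr]
    dsimp only
    omega
  have := Finset.card_le_card hsub
  rw [Finset.card_map, Nat.card_Ico] at this
  exact le_antisymm (card_block_le hr _) (by omega)

theorem card_le_of_containsCopy_blockGraph {α : Type*} [Fintype α] {F : SimpleGraph α}
    (hF : F.Preconnected) {n r : ℕ} (hr : 0 < r) (h : ContainsCopy F (blockGraph n r)) :
    Fintype.card α ≤ r := by
  obtain ⟨f, hf, hadj⟩ := h
  rcases isEmpty_or_nonempty α with _ | ⟨⟨a⟩⟩
  · simp
  have hsame (b : α) : (f b : ℕ) / r = (f a : ℕ) / r := by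
    obtain ⟨w⟩ := hF b a
    induction w with
    | nil => rfl
    | cons h _ ih => exact (hadj _ _ h).2.trans ih
  refine le_trans ?_ (card_block_le (n := n) hr (f a / r))
  rw [← Finset.card_univ]
  exact Finset.card_le_card_of_injOn f (fun b _ => by simpa [block] using hsame b) hf.injOn

theorem satGraph_blockGraph {n r : ℕ} (hr : 0 < r) (hn : r ∣ n) :
    SatGraph (dumbbell r) (blockGraph n r) := by
  refine ⟨fun h => ?_, fun u v huv hadj => ?_⟩
  · have := card_le_of_containsCopy_blockGraph (dumbbell_preconnected hr) hr h
    rw [Fintype.card_fin] at this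
    omega
  · refine containsCopy_dumbbell ((isNClique_block hr hn u).mono (le_addEdge _ u v))
      ((isNClique_block hr hn v).mono (le_addEdge _ u v)) ?_ (mem_block.2 rfl) (mem_block.2 rfl)
      ((addEdge_adj ..).2 (Or.inr ⟨rfl, huv⟩))
    rw [Finset.disjoint_left]
    intro x hx hy
    exact hadj ⟨huv, (mem_block.1 hx).symm.trans (mem_block.1 hy)⟩

theorem cycleCount_blockGraph {n r : ℕ} (hr : 0 < r) :
    cycleCount (blockGraph n r) (r + 1) = 0 := by
  refine cycleCount_eq_zero_iff.2 fun h => ?_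
  have := card_le_of_containsCopy_blockGraph cycleGraph_preconnected hr h
  simp at this

/-- Let `r ≥ 4` and let `B_{r,r}` be two disjoint copies of `K_r` joined by
an edge. Then (i) for every `n` divisible by `r` there is a `B_{r,r}`-saturated graph on `n`
vertices with no copy of `C_{r+1}`, so `sat(n, C_{r+1}, B_{r,r}) = 0`; and (ii) for every
`n ≥ 2r` not divisible by `r`, every `B_{r,r}`-saturated graph on `n` vertices contains a copy
of `C_{r+1}`, so `sat(n, C_{r+1}, B_{r,r}) ≥ 1`. -/
theorem dumbbell_cycle_saturation (r : ℕ) (hr : 4 ≤ r) :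
    (∀ n : ℕ, r ∣ n →
      (∃ G : SimpleGraph (Fin n), SatGraph (dumbbell r) G ∧ cycleCount G (r + 1) = 0) ∧
        satCyclesGraphSat n (r + 1) (dumbbell r) = 0) ∧
    (∀ n : ℕ, 2 * r ≤ n → ¬ r ∣ n →
      (∀ G : SimpleGraph (Fin n), SatGraph (dumbbell r) G → 1 ≤ cycleCount G (r + 1)) ∧
        1 ≤ satCyclesGraphSat n (r + 1) (dumbbell r)) := by
  have hr₀ : 0 < r := by omega
  refine ⟨fun n hn => ?_, fun n hn hdvd => ?_⟩
  · have h : ∃ G : SimpleGraph (Fin n), SatGraph (dumbbell r) G ∧ cycleCount G (r + 1) = 0 :=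
      ⟨blockGraph n r, satGraph_blockGraph hr₀ hn, cycleCount_blockGraph hr₀⟩
    exact ⟨h, Nat.sInf_eq_zero.2 (Or.inl h)⟩
  · have h (G : SimpleGraph (Fin n)) (hG : SatGraph (dumbbell r) G) :
        1 ≤ cycleCount G (r + 1) := by
      by_contra! hlt
      have hC := cycleCount_eq_zero_iff.1 (Nat.lt_one_iff.1 hlt)
      have := dvd_card_of_satGraph_dumbbell hr (by simpa using hn) hG hC
      exact hdvd (by simpa using this)
    refine ⟨h, ?_⟩
    have hedge : (dumbbell r).Adj ⟨0, by omega⟩ ⟨1, by omega⟩ := by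
      refine (dumbbell_adj _ _).2 ⟨by simp [Fin.ext_iff], Or.inl ⟨hr₀, ?_⟩⟩
      exact lt_of_lt_of_le (by norm_num) hr
    obtain ⟨G, hG⟩ := exists_satGraph (V := Fin n) hedge
    obtain ⟨G', hG', hm⟩ := Nat.sInf_mem
      (s := {m | ∃ G : SimpleGraph (Fin n), SatGraph (dumbbell r) G ∧ cycleCount G (r + 1) = m})
      ⟨_, G, hG, rfl⟩
    rw [satCyclesGraphSat, ← hm]
    exact h G' hG'
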